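/- (Higher-order negative slope motif with time-dependent inflows.) Let k₁, k₂ > 0 and k* = k₂/k₁. Let g_a, g_b : ℝ_{≥0} → ℝ_{≥0} and set G(t) = ∫₀ᵗ (g_a(s) + g_b(s)) ds. Assume G(t) → ∞ as t → ∞ and that g_a(t)/G(t)² → α as t → ∞ for some α ≥ 0. Let a, b : [0,∞) → ℝ_{>0} be differentiable with (a(0), b(0)) in the open positive quadrant, satisfying ȧ(t) = k₁·b(t)²·(k* − a(t)) + g_a(t) and ḃ(t) = −k₁·b(t)²·(k* − a(t)) + g_b(t). Then a(t) → k* + α/k₁ as t → ∞. -/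

import Mathlib

open Filter MeasureTheory Topology

/-- Once below the barrier `m`, always below. -/
lemma stay_aux (f f' : ℝ → ℝ) (T m : ℝ) (hf : ∀ t ≥ T, HasDerivAt f (f' t) t)
    (hneg : ∀ t ≥ T, f t = m → f' t < 0) (h0 : f T ≤ m) : ∀ t ≥ T, f t ≤ m := by
  intro t ht
  have key := @image_le_of_deriv_right_lt_deriv_boundary' f f' T t
    (fun x hx => (hf x hx.1).continuousAt.continuousWithinAt)
    (fun x hx => (hf x hx.1).hasDerivWithinAt) (fun _ => m) (fun _ => 0) h0
    continuousOn_const (fun x _ => hasDerivWithinAt_const _ _ _)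
    (fun x hx hxm => hneg x hx.1 hxm)
  exact key ⟨ht, le_rfl⟩

/-- If `f` decreases at a definite rate while above `m`, it is eventually below `m`. -/
lemma trap_aux (f f' : ℝ → ℝ) (T m δ : ℝ) (hδ : 0 < δ)
    (hf : ∀ t ≥ T, HasDerivAt f (f' t) t)
    (hneg : ∀ t ≥ T, m ≤ f t → f' t ≤ -δ) : ∃ T' ≥ T, ∀ t ≥ T', f t ≤ m := by
  by_cases h : ∃ t0 ≥ T, f t0 ≤ m
  · obtain ⟨t0, ht0, hm⟩ := h
    refine ⟨t0, ht0, stay_aux f f' t0 m (fun t ht => hf t (ht0.le.trans ht)) ?_ hm⟩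
    intro t ht hfm
    have := hneg t (ht0.le.trans ht) hfm.ge
    linarith
  · push Not at h
    exfalso
    set t1 := T + (f T - m) / δ with ht1
    have hT := h T le_rfl
    have h1 : T ≤ t1 := by
      have : 0 ≤ (f T - m) / δ := div_nonneg (by linarith) hδ.le
      linarith
    have key := @image_le_of_deriv_right_le_deriv_boundary f f' T t1
      (fun x hx => (hf x hx.1).continuousAt.continuousWithinAt)
      (fun x hx => (hf x hx.1).hasDerivWithinAt) (fun x => f T - δ * (x - T)) (fun _ => -δ)
      (by simp) (by fun_prop)
      (fun x _ => by
        have : HasDerivAt (fun x => f T - δ * (x - T)) (-δ) x := by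
          have := (((hasDerivAt_id x).sub_const T).const_mul δ).const_sub (f T)
          simpa using this
        exact this.hasDerivWithinAt)
      (fun x hx => hneg x hx.1 (h x hx.1).le)
    have h2 := key (x := t1) ⟨h1, le_rfl⟩
    have h3 := h t1 h1
    have h4 : δ * (t1 - T) = f T - m := by
      rw [ht1]; field_simp; ring
    linarith

/-- Higher-order negative slope motif with time-dependent inflows:
for `ȧ = k₁b²(k* − a) + g_a(t)`, `ḃ = −k₁b²(k* − a) + g_b(t)` with `k* = k₂/k₁`,
`G(t) = ∫₀ᵗ (g_a + g_b) → ∞` and `g_a(t)/G(t)² → α ≥ 0`, every positive solution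
satisfies `a(t) → k* + α/k₁`. -/
theorem stmt13 (k₁ k₂ ks : ℝ) (hk₁ : 0 < k₁) (hk₂ : 0 < k₂) (hks : ks = k₂ / k₁)
    (ga gb : ℝ → ℝ)
    (hga0 : ∀ t ≥ (0:ℝ), 0 ≤ ga t) (hgb0 : ∀ t ≥ (0:ℝ), 0 ≤ gb t)
    (G : ℝ → ℝ) (hG : ∀ t, G t = ∫ s in (0:ℝ)..t, (ga s + gb s))
    (hGtop : Tendsto G atTop atTop)
    (α : ℝ) (hα0 : 0 ≤ α)
    (hαlim : Tendsto (fun t => ga t / (G t) ^ 2) atTop (𝓝 α))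
    (a b : ℝ → ℝ)
    (hapos : ∀ t ≥ (0:ℝ), 0 < a t) (hbpos : ∀ t ≥ (0:ℝ), 0 < b t)
    (ha : ∀ t ≥ (0:ℝ), HasDerivAt a (k₁ * (b t) ^ 2 * (ks - a t) + ga t) t)
    (hb : ∀ t ≥ (0:ℝ), HasDerivAt b (-(k₁ * (b t) ^ 2 * (ks - a t)) + gb t) t) :
    Tendsto a atTop (𝓝 (ks + α / k₁)) := by
  have hkspos : 0 < ks := by rw [hks]; positivity
  have hS' : ∀ t ≥ (0:ℝ), HasDerivAt (fun t => a t + b t) (ga t + gb t) t := by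
    intro t ht
    have := (ha t ht).add (hb t ht)
    refine this.congr_deriv ?_
    ring
  have hSG : ∀ t ≥ (0:ℝ), a t + b t = (a 0 + b 0) + G t := by
    intro t ht
    have hc : ContinuousOn (fun t => a t + b t) (Set.Icc 0 t) :=
      fun x hx => (hS' x hx.1).continuousAt.continuousWithinAt
    have hint : IntervalIntegrable (fun s => ga s + gb s) volume 0 t := by
      rw [intervalIntegrable_iff_integrableOn_Ioc_of_le ht]
      exact intervalIntegral.integrableOn_deriv_of_nonneg hc
        (fun x hx => hS' x hx.1.le)
        (fun x hx => add_nonneg (hga0 x hx.1.le) (hgb0 x hx.1.le))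
    have := intervalIntegral.integral_eq_sub_of_hasDerivAt
      (fun x hx => hS' x (by rw [Set.uIcc_of_le ht] at hx; exact hx.1)) hint
    rw [hG t, this]; ring
  have hc0 : 0 < a 0 + b 0 := add_pos (hapos 0 le_rfl) (hbpos 0 le_rfl)
  have hev : ∀ M : ℝ, ∃ T ≥ (0:ℝ), ∀ t ≥ T, M ≤ G t := by
    intro M
    obtain ⟨T, hT⟩ := eventually_atTop.1 (hGtop.eventually_ge_atTop M)
    exact ⟨max T 0, le_max_right _ _, fun t ht => hT t ((le_max_left _ _).trans ht)⟩
  -- the limit `α` must vanish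
  have hα : α = 0 := by
    by_contra hne
    have hαp : 0 < α := lt_of_le_of_ne hα0 (Ne.symm hne)
    obtain ⟨T1, hT1⟩ := eventually_atTop.1 (hαlim.eventually_const_le (half_lt_self hαp))
    obtain ⟨T2, hT20, hT2⟩ := hev (a 0 + b 0)
    obtain ⟨T', hT', hle⟩ := trap_aux (fun t => (a t + b t)⁻¹)
      (fun t => -(ga t + gb t) / (a t + b t) ^ 2) (max T1 T2) 0 (α / 8) (by positivity)
      (fun t ht => by
        have h0 : 0 ≤ t := hT20.le.trans ((le_max_right _ _).trans ht)
        exact (hS' t h0).inv (add_pos (hapos t h0) (hbpos t h0)).ne')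
      (fun t ht _ => by
        have h0 : 0 ≤ t := hT20.le.trans ((le_max_right _ _).trans ht)
        have h1 := hT1 t ((le_max_left _ _).trans ht)
        have h2 := hT2 t ((le_max_right _ _).trans ht)
        have h3 := hSG t h0
        have hGp : 0 < G t := hc0.trans_le h2
        have hSp := add_pos (hapos t h0) (hbpos t h0)
        have h5 := hgb0 t h0
        rw [le_div_iff₀ (by positivity)] at h1
        rw [div_le_iff₀ (by positivity)]
        have h4 : (a t + b t) ^ 2 ≤ (2 * G t) ^ 2 := by
          apply pow_le_pow_left₀ hSp.le; linarith
        nlinarith)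
    have h0 : 0 ≤ T' := hT20.le.trans ((le_max_right _ _).trans hT')
    have := hle T' le_rfl
    have hSp := inv_pos.2 (add_pos (hapos T' h0) (hbpos T' h0))
    linarith
  subst hα
  -- `ga ≤ ε S²` eventually
  have hgaev : ∀ ε > (0:ℝ), ∃ T ≥ (0:ℝ), ∀ t ≥ T, ga t ≤ ε * (a t + b t) ^ 2 := by
    intro ε hε
    obtain ⟨T1, hT1⟩ := eventually_atTop.1 (hαlim.eventually_le_const hε)
    obtain ⟨T2, hT20, hT2⟩ := hev 1
    refine ⟨max T1 T2, hT20.le.trans (le_max_right _ _), fun t ht => ?_⟩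
    have h0 : 0 ≤ t := hT20.le.trans ((le_max_right _ _).trans ht)
    have h1 := hT1 t ((le_max_left _ _).trans ht)
    have h2 := hT2 t ((le_max_right _ _).trans ht)
    have h3 := hSG t h0
    have hGp : 0 < G t := by linarith
    rw [div_le_iff₀ (by positivity)] at h1
    have h4 : (G t) ^ 2 ≤ (a t + b t) ^ 2 := by
      apply pow_le_pow_left₀ hGp.le; linarith
    nlinarith
  have hSev : ∀ M : ℝ, ∃ T ≥ (0:ℝ), ∀ t ≥ T, M ≤ a t + b t := by
    intro M
    obtain ⟨T, hT0, hT⟩ := hev M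
    refine ⟨T, hT0, fun t ht => ?_⟩
    have := hSG t (hT0.le.trans ht)
    have := hT t ht
    linarith
  -- `b` is bounded below
  obtain ⟨T1, hT10, hT1⟩ := hSev (ks + 1)
  obtain ⟨β, hβ, hbβ⟩ : ∃ β > (0:ℝ), ∀ t ≥ T1, β ≤ b t := by
    have hbT := hbpos T1 hT10
    refine ⟨min (b T1) (1 / 2), by positivity, ?_⟩
    have := stay_aux (fun t => -b t) (fun t => -(-(k₁ * (b t) ^ 2 * (ks - a t)) + gb t)) T1
      (-(min (b T1) (1 / 2))) (fun t ht => (hb t (hT10.le.trans ht)).neg)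
      (fun t ht he => by
        have h0 : 0 ≤ t := hT10.le.trans ht
        have h1 := hT1 t ht
        have h2 := min_le_right (b T1) (1 / 2)
        have h3 := hgb0 t h0
        have h4 : 0 < a t - ks := by
          linarith
        have h5 : 0 < k₁ * (b t) ^ 2 * (a t - ks) := by
          have := hbpos t h0
          positivity
        linarith)
      (by simp)
    intro t ht
    have := this t ht
    linarith
  -- eventually `b ≥ S/2`
  obtain ⟨T4, hT4, hT41, hb2⟩ : ∃ T4 ≥ (0:ℝ), (∀ t ≥ T4, 1 ≤ a t + b t) ∧
      ∀ t ≥ T4, a t + b t ≤ 2 * b t := by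
    obtain ⟨T2, hT20, hT2⟩ := hSev (4 * ks + 1)
    obtain ⟨T3, hT30, hT3⟩ := hgaev (k₁ * β / 8) (by positivity)
    obtain ⟨T', hT', hle⟩ := trap_aux (fun t => (a t + b t) / b t)
      (fun t => ((ga t + gb t) * b t - (a t + b t) * (-(k₁ * (b t) ^ 2 * (ks - a t)) + gb t))
        / (b t) ^ 2) (max T1 (max T2 T3)) 2 (k₁ / 8) (by positivity)
      (fun t ht => by
        have h0 : 0 ≤ t := hT10.le.trans ((le_max_left _ _).trans ht)
        exact (hS' t h0).div (hb t h0) (hbpos t h0).ne')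
      (fun t ht hm => by
        have ht1 : T1 ≤ t := (le_max_left _ _).trans ht
        have ht2 : T2 ≤ t := (le_max_left _ _).trans ((le_max_right _ _).trans ht)
        have ht3 : T3 ≤ t := (le_max_right _ _).trans ((le_max_right _ _).trans ht)
        have h0 : 0 ≤ t := hT10.le.trans ht1
        have hbt := hbpos t h0
        have hat := hapos t h0
        have h1 := hbβ t ht1
        have h2 := hT2 t ht2
        have h3 := hT3 t ht3
        have h4 := hgb0 t h0
        rw [le_div_iff₀ hbt] at hm
        rw [div_le_iff₀ (by positivity)]
        obtain ⟨S, hS⟩ : ∃ S, S = a t + b t := ⟨_, rfl⟩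
        rw [← hS] at hm h2 h3 ⊢
        have e1 : S / 4 ≤ a t - ks := by linarith
        have e2 : ga t * b t ≤ k₁ / 8 * S ^ 2 * (b t) ^ 2 := by
          have : k₁ * β / 8 * S ^ 2 ≤ k₁ * b t / 8 * S ^ 2 := by gcongr
          nlinarith
        have e3 : gb t * b t ≤ gb t * S := by
          apply mul_le_mul_of_nonneg_left _ h4
          linarith
        have hS1 : 1 ≤ S := by linarith
        have e4 : S * (k₁ * (b t) ^ 2) * (S / 4) ≤ S * (k₁ * (b t) ^ 2) * (a t - ks) := by
          gcongr
        have e5 : k₁ / 8 * (b t) ^ 2 * 1 ≤ k₁ / 8 * (b t) ^ 2 * S ^ 2 := by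
          gcongr
          exact one_le_pow₀ hS1
        nlinarith)
    have hTT : T2 ≤ T' := (le_max_left _ _).trans ((le_max_right _ _).trans hT')
    refine ⟨T', hT20.le.trans hTT, fun t ht => ?_, fun t ht => ?_⟩
    · have := hT2 t (hTT.trans ht)
      linarith
    · have := hle t ht
      exact (div_le_iff₀ (hbpos t (hT20.le.trans (hTT.trans ht)))).1 this
  have hbS : ∀ t ≥ T4, (a t + b t) ^ 2 ≤ 4 * (b t) ^ 2 := by
    intro t ht
    have h0 : 0 ≤ t := hT4.le.trans ht
    have : (a t + b t) ^ 2 ≤ (2 * b t) ^ 2 :=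
      pow_le_pow_left₀ (add_pos (hapos t h0) (hbpos t h0)).le (hb2 t ht) 2
    linarith
  have hS1 : ∀ t ≥ T4, 1 ≤ (a t + b t) ^ 2 := fun t ht => one_le_pow₀ (hT41 t ht)
  rw [Metric.tendsto_atTop]
  intro e he
  obtain ⟨η, hη, hηe⟩ : ∃ η > 0, η < e := ⟨e / 2, by positivity, by linarith⟩
  obtain ⟨T5, hT5, hT5g⟩ := hgaev (k₁ * η / 8) (by positivity)
  obtain ⟨T6, hT6, hup⟩ := trap_aux a _ (max T4 T5) (ks + η) (k₁ * η / 8) (by positivity)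
    (fun t ht => ha t (hT4.le.trans ((le_max_left _ _).trans ht)))
    (fun t ht hm => by
      have h4 : T4 ≤ t := (le_max_left _ _).trans ht
      have h1 := hT5g t ((le_max_right _ _).trans ht)
      have h2 := hbS t h4
      have h3 := hS1 t h4
      have e1 : k₁ * (b t) ^ 2 * η ≤ k₁ * (b t) ^ 2 * (a t - ks) := by
        gcongr; linarith
      have e2 : k₁ * η * (a t + b t) ^ 2 ≤ k₁ * η * (4 * (b t) ^ 2) := by gcongr
      have e3 : k₁ * η * 1 ≤ k₁ * η * (a t + b t) ^ 2 := by gcongr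
      linarith)
  obtain ⟨T7, hT7, hlo⟩ := trap_aux (fun t => -a t) _ T4 (-(ks - η)) (k₁ * η / 4) (by positivity)
    (fun t ht => (ha t (hT4.le.trans ht)).neg)
    (fun t h4 hm => by
      have h1 := hga0 t (hT4.le.trans h4)
      have h2 := hbS t h4
      have h3 := hS1 t h4
      have e1 : k₁ * (b t) ^ 2 * η ≤ k₁ * (b t) ^ 2 * (ks - a t) := by
        gcongr
        linarith
      have e2 : k₁ * η * (a t + b t) ^ 2 ≤ k₁ * η * (4 * (b t) ^ 2) := by gcongr
      have e3 : k₁ * η * 1 ≤ k₁ * η * (a t + b t) ^ 2 := by gcongr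
      linarith)
  refine ⟨max T6 T7, fun t ht => ?_⟩
  have h6 := hup t ((le_max_left _ _).trans ht)
  have h7 := hlo t ((le_max_right _ _).trans ht)
  rw [zero_div, add_zero, Real.dist_eq, abs_lt]
  constructor <;> linarith
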